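/- Fix a > 0 and set T₀ = a/(2π); write z' = z + 1/a and let β(t,x,y,z) = (a/T₀)·(z', 0, 0, t) on the right Rindler wedge RRW = {z + 1/a > |t|}, with u = β/√(Q(β)) and A^μ = ∑_ν u^ν∂u^μ/∂x^ν. Then at every point of the RRW the comoving temperature T = 1/√(Q(β)) equals the Unruh temperature |A|/(2π), where |A| = √(−Q(A)). Moreover, then α² := Q(β)·Q(A) = −4π², so the canonical entropy-current coefficient 2π²/45 − α²/6 equals 32π²/45, which is exactly 16 times the improved entropy-current coefficient 2π²/45. -/

import Mathlib

open Real MeasureTheory Filter Topology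

noncomputable section

/-- Diagonal of the Minkowski metric diag(1,-1,-1,-1). -/
def ηd : Fin 4 → ℝ := ![1, -1, -1, -1]

/-- Minkowski quadratic form Q(v) = (v⁰)² − (v¹)² − (v²)² − (v³)². -/
def minkQ (v : Fin 4 → ℝ) : ℝ := ∑ μ, ηd μ * v μ * v μ

/-- Minkowski bilinear form η(v,w). -/
def minkB (v w : Fin 4 → ℝ) : ℝ := ∑ μ, ηd μ * v μ * w μ

/-- Covariant (lowered) components v_μ = η_{μν} v^ν. -/
def lo (v : Fin 4 → ℝ) (μ : Fin 4) : ℝ := ηd μ * v μ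

/-- Partial derivative ∂_μ of a scalar function on ℝ⁴. -/
def pd (μ : Fin 4) (f : (Fin 4 → ℝ) → ℝ) (x : Fin 4 → ℝ) : ℝ :=
  fderiv ℝ f x (Pi.single μ 1)

/-- Four-temperature field β(t,x,y,z) = (a/T₀)(z+1/a, 0, 0, t), with x = (t,x,y,z). -/
def betaF (a T₀ : ℝ) (x : Fin 4 → ℝ) : Fin 4 → ℝ :=
  fun μ => (a / T₀) * ![x 3 + 1 / a, 0, 0, x 0] μ

/-- The right Rindler wedge {z + 1/a > |t|}. -/
def RRW (a : ℝ) : Set (Fin 4 → ℝ) := {x | |x 0| < x 3 + 1 / a}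

/-- Flow velocity u = β/√(Q(β)). -/
def uF (a T₀ : ℝ) (x : Fin 4 → ℝ) : Fin 4 → ℝ :=
  fun μ => betaF a T₀ x μ / Real.sqrt (minkQ (betaF a T₀ x))

/-- Four-acceleration A^μ = u^ν ∂_ν u^μ. -/
def accF (a T₀ : ℝ) (x : Fin 4 → ℝ) : Fin 4 → ℝ :=
  fun μ => ∑ ν, uF a T₀ x ν * pd ν (fun y => uF a T₀ y μ) x

/-- Thermal acceleration α = √(Q(β))·A = A/T. -/
def alphaF (a T₀ : ℝ) (x : Fin 4 → ℝ) : Fin 4 → ℝ :=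
  fun μ => Real.sqrt (minkQ (betaF a T₀ x)) * accF a T₀ x μ

/-- The quadratic form of the four-temperature. -/
lemma minkQ_betaF (a T₀ : ℝ) (x : Fin 4 → ℝ) :
    minkQ (betaF a T₀ x) = (a / T₀) ^ 2 * ((x 3 + 1 / a) ^ 2 - x 0 ^ 2) := by
  simp [minkQ, betaF, ηd, Fin.sum_univ_four]
  ring

lemma RRW_sq_sub_sq_pos {a : ℝ} {x : Fin 4 → ℝ} (hx : x ∈ RRW a) :
    0 < (x 3 + 1 / a) ^ 2 - x 0 ^ 2 := by
  have h : |x 0| < x 3 + 1 / a := hx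
  have := sq_lt_sq' (by linarith [neg_abs_le (x 0), le_abs_self (x 0), abs_nonneg (x 0)])
    ((le_abs_self (x 0)).trans_lt h)
  linarith

/-- The norm of the four-temperature has differential `c² ((z + 1/a) dz - t dt) / √Q(β)`. -/
lemma hasFDerivAt_sqrt_minkQ_betaF {a T₀ : ℝ} (x : Fin 4 → ℝ)
    (hQ : minkQ (betaF a T₀ x) ≠ 0) :
    HasFDerivAt (fun y => Real.sqrt (minkQ (betaF a T₀ y)))
      (((a / T₀) ^ 2 / Real.sqrt (minkQ (betaF a T₀ x))) •
        ((x 3 + 1 / a) • ContinuousLinearMap.proj (R := ℝ) (φ := fun _ : Fin 4 => ℝ) 3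
          - x 0 • ContinuousLinearMap.proj (R := ℝ) (φ := fun _ : Fin 4 => ℝ) 0)) x := by
  simp only [minkQ_betaF] at hQ ⊢
  have h0 : HasFDerivAt (fun y : Fin 4 → ℝ => y 0) _ x := hasFDerivAt_apply (𝕜 := ℝ) 0 x
  have h3 : HasFDerivAt (fun y : Fin 4 → ℝ => y 3) _ x := hasFDerivAt_apply (𝕜 := ℝ) 3 x
  refine (((((h3.add_const (1 / a)).pow 2).sub (h0.pow 2)).const_mul
    ((a / T₀) ^ 2)).sqrt hQ).congr_fderiv ?_
  ext v
  simp
  ring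

/-- The acceleration of the Rindler flow. -/
lemma accF_eq {a T₀ : ℝ} (hc : a / T₀ ≠ 0) {x : Fin 4 → ℝ} (hx : x ∈ RRW a) (μ : Fin 4) :
    accF a T₀ x μ = ![x 0, 0, 0, x 3 + 1 / a] μ / ((x 3 + 1 / a) ^ 2 - x 0 ^ 2) := by
  have hD := RRW_sq_sub_sq_pos hx
  have hQ : 0 < minkQ (betaF a T₀ x) := by rw [minkQ_betaF]; positivity
  have hs := Real.sqrt_pos.2 hQ
  have hN := hasFDerivAt_sqrt_minkQ_betaF x hQ.ne'
  have hinv := (hasDerivAt_inv hs.ne').comp_hasFDerivAt x hN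
  have h0 : HasFDerivAt (fun y : Fin 4 → ℝ => y 0) _ x := hasFDerivAt_apply (𝕜 := ℝ) 0 x
  have h3 : HasFDerivAt (fun y : Fin 4 → ℝ => y 3) _ x := hasFDerivAt_apply (𝕜 := ℝ) 3 x
  have hu0 := ((h3.add_const (1 / a)).const_mul (a / T₀)).mul hinv
  have hu3 := (h0.const_mul (a / T₀)).mul hinv
  have e0 : (fun y => uF a T₀ y 0) = (fun y : Fin 4 → ℝ => a / T₀ * (y 3 + 1 / a)) *
      ((fun r => r⁻¹) ∘ fun y => Real.sqrt (minkQ (betaF a T₀ y))) := by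
    ext y; simp [uF, betaF, div_eq_mul_inv]
  have e3 : (fun y => uF a T₀ y 3) = (fun y : Fin 4 → ℝ => a / T₀ * y 0) *
      ((fun r => r⁻¹) ∘ fun y => Real.sqrt (minkQ (betaF a T₀ y))) := by
    ext y; simp [uF, betaF, div_eq_mul_inv]
  have e1 : (fun y => uF a T₀ y 1) = fun _ => 0 := by ext y; simp [uF, betaF]
  have e2 : (fun y => uF a T₀ y 2) = fun _ => 0 := by ext y; simp [uF, betaF]
  have v0 : uF a T₀ x 0 = a / T₀ * (x 3 + 1 / a) / Real.sqrt (minkQ (betaF a T₀ x)) := by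
    simp [uF, betaF]
  have v3 : uF a T₀ x 3 = a / T₀ * x 0 / Real.sqrt (minkQ (betaF a T₀ x)) := by
    simp [uF, betaF]
  rw [← e0] at hu0
  rw [← e3] at hu3
  rw [Function.comp_apply] at hu0 hu3
  have hDs : (x 3 + 1 / a) ^ 2 - x 0 ^ 2 =
      Real.sqrt (minkQ (betaF a T₀ x)) ^ 2 / (a / T₀) ^ 2 := by
    rw [Real.sq_sqrt hQ.le, minkQ_betaF, mul_div_cancel_left₀ _ (pow_ne_zero 2 hc)]
  simp only [accF, pd, Fin.sum_univ_four, v0, v3]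
  generalize Real.sqrt (minkQ (betaF a T₀ x)) = s at *
  fin_cases μ
  · simp only [Fin.zero_eta, hu0.fderiv]
    simp [uF, betaF, -one_div]
    generalize x 3 + 1 / a = Z at *
    rw [hDs]
    generalize a / T₀ = c at *
    field_simp
    ring
  · simp [e1]
  · simp [e2]
  · simp only [Fin.reduceFinMk, hu3.fderiv]
    simp [uF, betaF, -one_div]
    generalize x 3 + 1 / a = Z at *
    rw [hDs]
    generalize a / T₀ = c at *
    field_simp
    ring

/-- The quadratic form of the acceleration of the Rindler flow. -/
lemma minkQ_accF {a T₀ : ℝ} (hc : a / T₀ ≠ 0) {x : Fin 4 → ℝ} (hx : x ∈ RRW a) :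
    minkQ (accF a T₀ x) = -(1 / ((x 3 + 1 / a) ^ 2 - x 0 ^ 2)) := by
  have hD := RRW_sq_sub_sq_pos hx
  simp only [minkQ, ηd, Fin.sum_univ_four, accF_eq hc hx]
  generalize x 3 + 1 / a = Z at *
  simp
  field_simp
  ring

/-- With T₀ = a/(2π) (Unruh effect / Minkowski vacuum), on the right Rindler
wedge the comoving temperature 1/√(Q(β)) equals the Unruh temperature
√(−Q(A))/(2π); moreover α² = Q(β)Q(A) = −4π², so the canonical entropy-current
coefficient 2π²/45 − α²/6 equals 32π²/45, which is 16 times the improved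
coefficient 2π²/45. -/
theorem unruh_temperature_and_entropy_coefficients
    (a : ℝ) (ha : 0 < a) (T₀ : ℝ) (hT₀ : T₀ = a / (2 * Real.pi)) :
    ∀ x ∈ RRW a,
      1 / Real.sqrt (minkQ (betaF a T₀ x)) =
        Real.sqrt (-minkQ (accF a T₀ x)) / (2 * Real.pi) ∧
      minkQ (betaF a T₀ x) * minkQ (accF a T₀ x) = -(4 * Real.pi ^ 2) ∧
      2 * Real.pi ^ 2 / 45 - (minkQ (betaF a T₀ x) * minkQ (accF a T₀ x)) / 6 =
        32 * Real.pi ^ 2 / 45 ∧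
      32 * Real.pi ^ 2 / 45 = 16 * (2 * Real.pi ^ 2 / 45) := by
  intro x hx
  have hπ := Real.pi_pos
  have hc : a / T₀ = 2 * Real.pi := by rw [hT₀]; field_simp
  have hD := RRW_sq_sub_sq_pos hx
  have hβ : minkQ (betaF a T₀ x) = (2 * Real.pi) ^ 2 * ((x 3 + 1 / a) ^ 2 - x 0 ^ 2) := by
    rw [minkQ_betaF, hc]
  have hA : minkQ (accF a T₀ x) = -(1 / ((x 3 + 1 / a) ^ 2 - x 0 ^ 2)) := by
    rw [minkQ_accF (by rw [hc]; positivity) hx]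
  have hα : minkQ (betaF a T₀ x) * minkQ (accF a T₀ x) = -(4 * Real.pi ^ 2) := by
    rw [hβ, hA, mul_neg, mul_one_div, mul_div_cancel_right₀ _ hD.ne']
    ring
  refine ⟨?_, hα, by rw [hα]; ring, by ring⟩
  rw [hβ, hA, neg_neg, Real.sqrt_mul (sq_nonneg _), Real.sqrt_sq (by positivity),
    Real.sqrt_div zero_le_one, Real.sqrt_one, div_div, mul_comm]
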